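/- Let n ≥ 1 be an integer, let Pₙ denote the n-th Legendre polynomial, and let ω : ℝ → ℝ be smooth. Then the function φ(r,t) = ∫_{−1}^{1} ω(rα + t − 1) Pₙ(α) dα (equivalently, φ(r,t) = (1/r) ∫_{t−1−r}^{t−1+r} ω(τ) Pₙ((τ+1−t)/r) dτ) satisfies, for all r > 0 and all t, the radial wave equation ∂ₜₜφ − ∂ᵣᵣφ − (2/r) ∂ᵣφ + (n(n+1)/r²) φ = 0. -/

import Mathlib

noncomputable section

/-- The `n`-th Legendre polynomial via Rodrigues' formula. -/
def legendreFn (n : ℕ) (y : ℝ) : ℝ :=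
  (1 / (2 ^ n * n.factorial)) * iteratedDeriv n (fun z : ℝ => (z ^ 2 - 1) ^ n) y

section Legendre

open Polynomial

/-- The differential equation satisfied by the derivatives of `(X ^ 2 - 1) ^ n`. -/
theorem iterate_derivative_sq_sub_one_pow_ode (n k : ℕ) :
    (X ^ 2 - 1 : ℝ[X]) * derivative^[k + 2] ((X ^ 2 - 1) ^ n) +
      2 * X * ((k : ℝ[X]) + 1 - (n : ℝ[X])) * derivative^[k + 1] ((X ^ 2 - 1) ^ n) +
      (((k : ℝ[X]) + 1) * (k : ℝ[X]) - 2 * (n : ℝ[X]) * ((k : ℝ[X]) + 1)) *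
        derivative^[k] ((X ^ 2 - 1) ^ n) = 0 := by
  induction k with
  | zero =>
    have h : (X ^ 2 - 1 : ℝ[X]) * derivative ((X ^ 2 - 1) ^ n) =
        2 * (n : ℝ[X]) * X * (X ^ 2 - 1) ^ n := by
      cases n with
      | zero => simp
      | succ m =>
        simp [derivative_pow, map_ofNat C]
        ring
    have h' := congrArg derivative h
    simp [derivative_mul] at h'
    simp only [Function.iterate_succ_apply', Function.iterate_zero, id]
    push_cast
    linear_combination h'
  | succ k ih =>
    simp only [Function.iterate_succ_apply'] at ih ⊢
    generalize derivative^[k] ((X ^ 2 - 1 : ℝ[X]) ^ n) = v at ih ⊢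
    have h' := congrArg derivative ih
    simp only [derivative_add, derivative_mul, derivative_sub, derivative_X_sq, derivative_one,
      derivative_natCast, derivative_X, derivative_ofNat, derivative_zero, map_ofNat] at h'
    push_cast
    linear_combination h'

/-- The Legendre polynomial as a formal polynomial. -/
def legendrePoly (n : ℕ) : ℝ[X] :=
  C (1 / (2 ^ n * n.factorial) : ℝ) * derivative^[n] ((X ^ 2 - 1) ^ n)

theorem iteratedDeriv_polynomial_eval (p : ℝ[X]) (k : ℕ) :
    iteratedDeriv k (fun x => p.eval x) = fun x => (derivative^[k] p).eval x := by
  induction k with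
  | zero => simp
  | succ k ih =>
    ext x
    rw [iteratedDeriv_succ, ih, Function.iterate_succ_apply']
    exact Polynomial.deriv _

theorem legendreFn_eq_eval (n : ℕ) (y : ℝ) : legendreFn n y = (legendrePoly n).eval y := by
  have h : (fun z : ℝ => (z ^ 2 - 1) ^ n) = fun z => ((X ^ 2 - 1 : ℝ[X]) ^ n).eval z := by
    ext z; simp
  rw [legendreFn, h, iteratedDeriv_polynomial_eval, legendrePoly, eval_mul, eval_C]

/-- The Legendre equation. -/
theorem legendrePoly_ode (n : ℕ) (y : ℝ) :
    (1 - y ^ 2) * (derivative (derivative (legendrePoly n))).eval y -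
      2 * y * (derivative (legendrePoly n)).eval y +
      n * (n + 1) * (legendrePoly n).eval y = 0 := by
  have h := congrArg (eval y) (iterate_derivative_sq_sub_one_pow_ode n n)
  simp only [Function.iterate_succ_apply'] at h
  simp only [eval_add, eval_mul, eval_sub, eval_pow, eval_X, eval_one, eval_natCast,
    eval_ofNat, eval_zero] at h
  simp only [legendrePoly, derivative_C_mul, eval_mul, eval_C]
  linear_combination -(1 / (2 ^ n * n.factorial) : ℝ) * h

end Legendre

/-- Differentiation under the integral sign over a compact interval. -/
theorem hasDerivAt_intervalIntegral_of_continuous {F F' : ℝ → ℝ → ℝ} {a b : ℝ}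
    (hF : ∀ x, Continuous (F x)) (hF' : Continuous (Function.uncurry F'))
    (h : ∀ x y, HasDerivAt (fun x => F x y) (F' x y) x) (x₀ : ℝ) :
    HasDerivAt (fun x => ∫ y in a..b, F x y) (∫ y in a..b, F' x₀ y) x₀ := by
  obtain ⟨C, hC⟩ := ((isCompact_closedBall x₀ 1).prod (isCompact_uIcc (a := a) (b := b))
    ).exists_bound_of_continuousOn hF'.continuousOn
  refine (intervalIntegral.hasDerivAt_integral_of_dominated_loc_of_deriv_le
    (bound := fun _ => C) (Metric.closedBall_mem_nhds x₀ one_pos)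
    (.of_forall fun x => (hF x).aestronglyMeasurable) ((hF x₀).intervalIntegrable _ _)
    (hF'.comp (Continuous.prodMk_right x₀)).aestronglyMeasurable
    (.of_forall fun y hy x hx => hC (x, y) ⟨hx, Set.uIoc_subset_uIcc hy⟩)
    intervalIntegrable_const (.of_forall fun y _ x _ => h x y)).2

section LegendreAverage

variable {g g' : ℝ → ℝ} {w : ℝ → ℝ}

theorem hasDerivAt_integral_comp_time (hg' : Continuous g') (hw : Continuous w)
    (h : ∀ x, HasDerivAt g (g' x) x) (r t : ℝ) :
    HasDerivAt (fun s => ∫ y in (-1 : ℝ)..1, g (r * y + s - 1) * w y)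
      (∫ y in (-1 : ℝ)..1, g' (r * y + t - 1) * w y) t := by
  have hg : Continuous g := continuous_iff_continuousAt.2 fun x => (h x).continuousAt
  refine hasDerivAt_intervalIntegral_of_continuous (F' := fun s y => g' (r * y + s - 1) * w y)
    (fun s => by fun_prop) (by unfold Function.uncurry; fun_prop) (fun s y => ?_) t
  have h₁ : HasDerivAt (fun s => r * y + s - 1) 1 s :=
    ((hasDerivAt_id s).const_add _).sub_const _
  simpa using ((h _).comp s h₁).mul_const (w y)

theorem hasDerivAt_integral_comp_radius (hg' : Continuous g') (hw : Continuous w)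
    (h : ∀ x, HasDerivAt g (g' x) x) (r t : ℝ) :
    HasDerivAt (fun ρ => ∫ y in (-1 : ℝ)..1, g (ρ * y + t - 1) * w y)
      (∫ y in (-1 : ℝ)..1, g' (r * y + t - 1) * (y * w y)) r := by
  have hg : Continuous g := continuous_iff_continuousAt.2 fun x => (h x).continuousAt
  refine hasDerivAt_intervalIntegral_of_continuous
    (F' := fun ρ y => g' (ρ * y + t - 1) * (y * w y))
    (fun s => by fun_prop) (by unfold Function.uncurry; fun_prop) (fun ρ y => ?_) r
  have h₁ : HasDerivAt (fun ρ => ρ * y + t - 1) y ρ := by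
    simpa using (((hasDerivAt_id ρ).mul_const y).add_const t).sub_const 1
  simpa [mul_assoc] using ((h _).comp ρ h₁).mul_const (w y)

end LegendreAverage

/-- Integrating the Legendre equation by parts against a function of `r * y + t - 1`. -/
theorem integral_legendrePoly_wave {g g' g'' : ℝ → ℝ} (hg'' : Continuous g'')
    (h : ∀ x, HasDerivAt g (g' x) x) (h' : ∀ x, HasDerivAt g' (g'' x) x)
    (n : ℕ) {r : ℝ} (hr : r ≠ 0) (t : ℝ) :
    (∫ y in (-1 : ℝ)..1, g'' (r * y + t - 1) * (legendrePoly n).eval y) -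
      (∫ y in (-1 : ℝ)..1, g'' (r * y + t - 1) * (y * (y * (legendrePoly n).eval y))) -
      2 / r * (∫ y in (-1 : ℝ)..1, g' (r * y + t - 1) * (y * (legendrePoly n).eval y)) +
      n * (n + 1) / r ^ 2 *
        (∫ y in (-1 : ℝ)..1, g (r * y + t - 1) * (legendrePoly n).eval y) = 0 := by
  have hg : Continuous g := continuous_iff_continuousAt.2 fun x => (h x).continuousAt
  have hg' : Continuous g' := continuous_iff_continuousAt.2 fun x => (h' x).continuousAt
  set p := legendrePoly n with hp
  have hpc : Continuous fun y => p.eval y := p.continuous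
  rw [← intervalIntegral.integral_const_mul, ← intervalIntegral.integral_const_mul,
    ← intervalIntegral.integral_sub, ← intervalIntegral.integral_sub,
    ← intervalIntegral.integral_add]
  rotate_left
  iterate 6 exact Continuous.intervalIntegrable (by fun_prop) _ _
  have key : ∀ y, HasDerivAt (fun y => (1 - y ^ 2) * (g' (r * y + t - 1) * p.eval y / r -
      g (r * y + t - 1) * p.derivative.eval y / r ^ 2))
      (g'' (r * y + t - 1) * p.eval y - g'' (r * y + t - 1) * (y * (y * p.eval y)) -
        2 / r * (g' (r * y + t - 1) * (y * p.eval y)) +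
        n * (n + 1) / r ^ 2 * (g (r * y + t - 1) * p.eval y)) y := by
    intro y
    have h₁ : HasDerivAt (fun y => r * y + t - 1) r y := by
      simpa using (((hasDerivAt_id y).const_mul r).add_const t).sub_const 1
    have h₂ : HasDerivAt (fun y : ℝ => 1 - y ^ 2) (-(2 * y)) y := by
      simpa using (hasDerivAt_pow 2 y).const_sub 1
    have h₃ := h₂.mul (((((h' _).comp y h₁).mul (p.hasDerivAt y)).div_const r).sub
      ((((h _).comp y h₁).mul (p.derivative.hasDerivAt y)).div_const (r ^ 2)))
    refine h₃.congr_deriv ?_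
    have ode := legendrePoly_ode n y
    rw [← hp] at ode
    simp only [Function.comp_apply, Pi.mul_apply, Pi.sub_apply]
    generalize g (r * y + t - 1) = a, g' (r * y + t - 1) = b, g'' (r * y + t - 1) = c
    field_simp
    linear_combination (-a) * ode
  rw [intervalIntegral.integral_eq_sub_of_hasDerivAt (fun y _ => key y)
    (Continuous.intervalIntegrable (by fun_prop) _ _)]
  norm_num

/-- For `n ≥ 1` and smooth `ω`, the function
`φ(r,t) = ∫_{−1}^{1} ω(rα + t − 1) Pₙ(α) dα = (1/r) ∫_{t−1−r}^{t−1+r} ω(τ) Pₙ((τ+1−t)/r) dτ`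
satisfies the radial wave equation `∂ₜₜφ − ∂ᵣᵣφ − (2/r)∂ᵣφ + (n(n+1)/r²)φ = 0`
for all `r > 0` and all `t`. -/
theorem statement10
    (n : ℕ) (hn : 1 ≤ n)
    (ω : ℝ → ℝ) (hω : ContDiff ℝ (⊤ : ℕ∞) ω)
    (φ : ℝ → ℝ → ℝ)
    (hφ : ∀ (r t : ℝ),
      φ r t = ∫ α in (-1:ℝ)..1, ω (r * α + t - 1) * legendreFn n α) :
    (∀ (r t : ℝ), 0 < r →
      φ r t = (1 / r) * ∫ τ in (t - 1 - r)..(t - 1 + r), ω τ * legendreFn n ((τ + 1 - t) / r)) ∧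
    (∀ (r t : ℝ), 0 < r →
      iteratedDeriv 2 (fun s => φ r s) t - iteratedDeriv 2 (fun ρ => φ ρ t) r -
        (2 / r) * deriv (fun ρ => φ ρ t) r + ((n * (n + 1) : ℝ) / r ^ 2) * φ r t = 0) := by
  simp only [legendreFn_eq_eval] at hφ ⊢
  refine ⟨fun r t hr => ?_, fun r t hr => ?_⟩
  · have h := intervalIntegral.integral_comp_mul_add (a := -1) (b := 1)
      (fun τ => ω τ * (legendrePoly n).eval ((τ + 1 - t) / r)) hr.ne' (t - 1)
    rw [hφ, one_div, ← smul_eq_mul, show t - 1 - r = r * -1 + (t - 1) by ring,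
      show t - 1 + r = r * 1 + (t - 1) by ring, ← h]
    refine intervalIntegral.integral_congr fun y _ => ?_
    have h₁ : (r * y + (t - 1) + 1 - t) / r = y := by
      field_simp
      ring
    simp only [h₁]
    rw [add_sub_assoc]
  · have hω₁ : ContDiff ℝ (⊤ : ℕ∞) (deriv ω) := (contDiff_infty_iff_deriv.1 hω).2
    have hω₂ : ContDiff ℝ (⊤ : ℕ∞) (deriv (deriv ω)) := (contDiff_infty_iff_deriv.1 hω₁).2
    have h : ∀ x, HasDerivAt ω (deriv ω x) x := fun x =>
      ((contDiff_infty_iff_deriv.1 hω).1 x).hasDerivAt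
    have h' : ∀ x, HasDerivAt (deriv ω) (deriv (deriv ω) x) x := fun x =>
      ((contDiff_infty_iff_deriv.1 hω₁).1 x).hasDerivAt
    have hp : Continuous fun y => (legendrePoly n).eval y := (legendrePoly n).continuous
    have hyp : Continuous fun y => y * (legendrePoly n).eval y := continuous_id.mul hp
    simp only [hφ, iteratedDeriv_succ, iteratedDeriv_zero]
    rw [funext fun s => (hasDerivAt_integral_comp_time hω₁.continuous hp h r s).deriv,
      (hasDerivAt_integral_comp_time hω₂.continuous hp h' r t).deriv,
      funext fun ρ => (hasDerivAt_integral_comp_radius hω₁.continuous hp h ρ t).deriv,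
      (hasDerivAt_integral_comp_radius hω₂.continuous hyp h' r t).deriv]
    exact integral_legendrePoly_wave hω₂.continuous h h' n hr.ne' t
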